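/- Let n ≥ 1 and let L(t, x, v, w) = Σ_j α_j(t, x, v) w^j + β(t, x, v) be a smooth second-order Lagrange function which is affine in the acceleration variables w, with α_j and β smooth on ℝ × (ℝⁿ)². Then its Euler–Poisson expressions E_i = ∂L/∂x^i − D_t(∂L/∂v^i) + D_t²(∂L/∂w^i), which are functions of (t, x, v, w, w′) only, satisfy identically E_i = A_{ij} w′^j + w^k (∂A_{ij}/∂v^k) w^j + B_{ij} w^j + c_i, where A_{ij} = ∂α_i/∂v^j − ∂α_j/∂v^i (skew-symmetric), c_i = b_i evaluated at w = 0, and B_{ij} = ∂b_i/∂w^j evaluated at w = 0, with b_i = ∂L/∂x^i − D₂(∂L/∂v^i) + D₂²(∂L/∂w^i) and D₂ = ∂_t + v·∂_x + w·∂_v; in particular A, B, c depend only on (t, x, v), and b_i is a polynomial of degree ≤ 2 in w whose quadratic part equals w^k (∂A_{ij}/∂v^k) w^j. -/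

import Mathlib

noncomputable section

/-- Jet variables: time `t` together with rows `y₀, …, y_{N-1}` of `n` variables each. -/
abbrev Jet (n N : ℕ) : Type := ℝ × (Fin N → Fin n → ℝ)

/-- Coordinate access, out-of-range rows giving `0`. -/
def coord {n N : ℕ} (p : Jet n N) (r : ℕ) (i : Fin n) : ℝ :=
  if h : r < N then p.2 ⟨r, h⟩ i else 0

/-- Partial derivative in the time direction. -/
def pderT {n N : ℕ} (F : Jet n N → ℝ) (p : Jet n N) : ℝ :=
  fderiv ℝ F p (1, 0)

/-- Partial derivative in the `i`-th variable of the `r`-th row `y_r`. -/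
def pderY {n N : ℕ} (r : ℕ) (i : Fin n) (F : Jet n N → ℝ) : Jet n N → ℝ :=
  fun p => fderiv ℝ F p (0, fun r' => if (r' : ℕ) = r then Pi.single i 1 else 0)

/-- The total (formal time) derivative `D_t F = ∂F/∂t + Σ_r Σ_i y_{r+1}^i ∂F/∂y_r^i`,
truncated at the top row. -/
def totD {n N : ℕ} (F : Jet n N → ℝ) : Jet n N → ℝ :=
  fun p => pderT F p + ∑ r ∈ Finset.range N, ∑ i : Fin n, coord p (r + 1) i * pderY r i F p

/-- Extension of a function of a lower-order jet to a higher-order jet space. -/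
def extJ {n : ℕ} {N M : ℕ} (h : N ≤ M) (F : Jet n N → ℝ) : Jet n M → ℝ :=
  fun p => F (p.1, fun r => p.2 (Fin.castLE h r))

/-- Truncation of a jet to lower order. -/
def trJ {n : ℕ} {M : ℕ} (N : ℕ) (h : N ≤ M) (p : Jet n M) : Jet n N :=
  (p.1, fun r => p.2 (Fin.castLE h r))


/-- The Euler–Poisson expressions `E_i(L) = ∂L/∂x^i − D_t(∂L/∂v^i) + D_t²(∂L/∂w^i)` of a
second-order Lagrange function `L(t,x,v,w)`, as functions of `(t,x,v,w,w′,w″)`. -/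
def eulerPoisson2 {n : ℕ} (L : Jet n 3 → ℝ) (i : Fin n) : Jet n 5 → ℝ :=
  fun p =>
    pderY 0 i (extJ (M := 5) (by omega) L) p
      - totD (pderY 1 i (extJ (M := 5) (by omega) L)) p
      + totD (totD (pderY 2 i (extJ (M := 5) (by omega) L))) p

/-- Antisymmetrization (weight `1/3!`) over three indices. -/
def alt3v {n : ℕ} (f : Fin n → Fin n → Fin n → ℝ) (i j k : Fin n) : ℝ :=
  (f i j k - f j i k + f j k i - f k j i + f k i j - f i k j) / 6

/-- Symmetrization (weight `1/3!`) over three indices. -/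
def sym3v {n : ℕ} (f : Fin n → Fin n → Fin n → ℝ) (i j k : Fin n) : ℝ :=
  (f i j k + f j i k + f j k i + f k j i + f k i j + f i k j) / 6

/-- Embedding of `(t,x,v)` into `(t,x,v,w)` with `w = 0`. -/
def embW0 {n : ℕ} (q : Jet n 2) : Jet n 3 :=
  (q.1, fun r => if h : (r : ℕ) < 2 then q.2 ⟨(r : ℕ), h⟩ else 0)

/-- The vector `(0, δ_{r,r'} e_i)` along which `pderY r i` differentiates. -/
def jetUnit (n N r : ℕ) (i : Fin n) : Jet n N :=
  (0, fun r' => if (r' : ℕ) = r then Pi.single i 1 else 0)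

/-- The total derivative at `p` as a tangent vector. -/
def totVec {n N : ℕ} (p : Jet n N) : Jet n N := (1, fun r i => coord p (r + 1) i)

lemma pderY_eq_fderiv {n N : ℕ} (r : ℕ) (i : Fin n) (F : Jet n N → ℝ) (p : Jet n N) :
    pderY r i F p = fderiv ℝ F p (jetUnit n N r i) := rfl

lemma totVec_eq {n N : ℕ} (p : Jet n N) :
    totVec p = (1, 0) + ∑ r ∈ Finset.range N, ∑ i : Fin n, coord p (r + 1) i • jetUnit n N r i := by
  ext
  · simp [totVec, jetUnit, Prod.fst_sum]
  · rename_i r k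
    simp only [totVec, jetUnit, Prod.snd_add, Prod.snd_sum, Prod.smul_snd, Pi.add_apply,
      Finset.sum_apply, Pi.smul_apply, Pi.zero_apply, zero_add, smul_eq_mul]
    rw [Finset.sum_eq_single_of_mem (r : ℕ) (Finset.mem_range.2 r.2)]
    · simp [Pi.single_apply]
    · intro s _ hs
      simp [hs.symm]

lemma totD_eq_fderiv {n N : ℕ} (F : Jet n N → ℝ) (p : Jet n N) :
    totD F p = fderiv ℝ F p (totVec p) := by
  rw [totVec_eq, map_add, map_sum]
  simp [totD, pderT, pderY_eq_fderiv, map_sum]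

/-- `coord` as a continuous linear functional. -/
def coordL (n N r : ℕ) (i : Fin n) : Jet n N →L[ℝ] ℝ :=
  if h : r < N then
    (ContinuousLinearMap.proj (R := ℝ) (φ := fun _ : Fin n => ℝ) i).comp
      ((ContinuousLinearMap.proj (R := ℝ) (φ := fun _ : Fin N => Fin n → ℝ) ⟨r, h⟩).comp
        (ContinuousLinearMap.snd ℝ ℝ (Fin N → Fin n → ℝ)))
  else 0

lemma coordL_apply {n N : ℕ} (r : ℕ) (i : Fin n) (p : Jet n N) :
    coordL n N r i p = coord p r i := by
  unfold coordL coord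
  split_ifs <;> rfl

lemma coord_eq_coordL (n N r : ℕ) (i : Fin n) :
    (fun p : Jet n N => coord p r i) = coordL n N r i :=
  funext fun p => (coordL_apply r i p).symm

lemma contDiff_coord (n N r : ℕ) (i : Fin n) :
    ContDiff ℝ (⊤ : ℕ∞) (fun p : Jet n N => coord p r i) := by
  rw [coord_eq_coordL]
  exact (coordL n N r i).contDiff

lemma fderiv_coord {n N : ℕ} (r : ℕ) (i : Fin n) (p e : Jet n N) :
    fderiv ℝ (fun p : Jet n N => coord p r i) p e = coord e r i := by
  rw [coord_eq_coordL, (coordL n N r i).fderiv, coordL_apply]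

/-- `trJ` as a continuous linear map. -/
def trL (n : ℕ) {N M : ℕ} (h : N ≤ M) : Jet n M →L[ℝ] Jet n N :=
  (ContinuousLinearMap.fst ℝ ℝ _).prod
    (ContinuousLinearMap.pi fun r =>
      (ContinuousLinearMap.proj (Fin.castLE h r)).comp (ContinuousLinearMap.snd ℝ ℝ _))

lemma trJ_eq_trL (n : ℕ) {N M : ℕ} (h : N ≤ M) :
    (trJ N h : Jet n M → Jet n N) = trL n h := rfl

lemma contDiff_comp_trJ {n N M : ℕ} (h : N ≤ M) {f : Jet n N → ℝ}
    (hf : ContDiff ℝ (⊤ : ℕ∞) f) :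
    ContDiff ℝ (⊤ : ℕ∞) (fun p : Jet n M => f (trJ N h p)) :=
  hf.comp (trL n h).contDiff

lemma fderiv_comp_trJ {n N M : ℕ} (h : N ≤ M) {f : Jet n N → ℝ}
    (hf : ContDiff ℝ (⊤ : ℕ∞) f) (p e : Jet n M) :
    fderiv ℝ (fun p : Jet n M => f (trJ N h p)) p e = fderiv ℝ f (trJ N h p) (trJ N h e) := by
  have h1 : DifferentiableAt ℝ f (trL n h p) := (hf.differentiable (by simp)) _
  have := (h1.hasFDerivAt.comp p (trL n h).hasFDerivAt).fderiv
  rw [trJ_eq_trL]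
  exact congrArg (fun T => T e) this

lemma contDiff_pderY {n N : ℕ} (r : ℕ) (i : Fin n) {F : Jet n N → ℝ}
    (hF : ContDiff ℝ (⊤ : ℕ∞) F) : ContDiff ℝ (⊤ : ℕ∞) (pderY r i F) :=
  (hF.fderiv_right (m := (⊤ : ℕ∞)) (by simp)).clm_apply contDiff_const

lemma contDiff_totD {n N : ℕ} {F : Jet n N → ℝ}
    (hF : ContDiff ℝ (⊤ : ℕ∞) F) : ContDiff ℝ (⊤ : ℕ∞) (totD F) := by
  refine ContDiff.add
    ((hF.fderiv_right (m := (⊤ : ℕ∞)) (by simp)).clm_apply contDiff_const) ?_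
  exact ContDiff.sum fun r _ => ContDiff.sum fun i _ =>
    (contDiff_coord n N (r + 1) i).mul (contDiff_pderY r i hF)

lemma coord_jetUnit {n N r s : ℕ} (hs : s < N) (i j : Fin n) :
    coord (jetUnit n N r i) s j = if s = r ∧ j = i then 1 else 0 := by
  by_cases h : s = r <;> simp [coord, jetUnit, hs, h, Pi.single_apply]
  simp [← h, hs]

lemma coord_totVec {n N r : ℕ} (hr : r < N) (p : Jet n N) (i : Fin n) :
    coord (totVec p) r i = coord p (r + 1) i := by
  simp [coord, totVec, hr]

lemma trJ_jetUnit {n N M : ℕ} (h : N ≤ M) (r : ℕ) (i : Fin n) :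
    trJ N h (jetUnit n M r i) = jetUnit n N r i := rfl

lemma jetUnit_eq_zero {n N r : ℕ} (h : N ≤ r) (i : Fin n) : jetUnit n N r i = 0 := by
  ext
  · rfl
  · rename_i s k
    have : (s : ℕ) ≠ r := by omega
    simp [jetUnit, this]

lemma trJ_totVec {n M : ℕ} (h : 2 ≤ M) (p : Jet n M) :
    trJ 2 h (totVec p) = totVec (trJ 2 h p) + ∑ k, coord p 2 k • jetUnit n 2 1 k := by
  ext
  · simp [trJ, totVec, jetUnit, Prod.fst_sum]
  · rename_i r k
    simp only [Prod.snd_add, Prod.snd_sum, Prod.smul_snd, Pi.add_apply, Finset.sum_apply,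
      Pi.smul_apply, smul_eq_mul, trJ, totVec, jetUnit]
    fin_cases r
    · simp [coord, show 1 < M by omega]
      rfl
    · simp [coord, Pi.single_apply]

lemma totD_comp_trJ {n M : ℕ} (h : 2 ≤ M) {f : Jet n 2 → ℝ}
    (hf : ContDiff ℝ (⊤ : ℕ∞) f) (p : Jet n M) :
    totD (fun p : Jet n M => f (trJ 2 h p)) p =
      totD f (trJ 2 h p) + ∑ k, coord p 2 k * pderY 1 k f (trJ 2 h p) := by
  rw [totD_eq_fderiv, fderiv_comp_trJ h hf, trJ_totVec, map_add, map_sum, totD_eq_fderiv]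
  simp [pderY_eq_fderiv]

/-- Leibniz rule for `g ∘ tr + Σ_j w^j (f_j ∘ tr)`, differentiated in an arbitrary direction. -/
lemma fderiv_affine {n M : ℕ} (h : 2 ≤ M) {f : Fin n → Jet n 2 → ℝ} {g : Jet n 2 → ℝ}
    (hf : ∀ j, ContDiff ℝ (⊤ : ℕ∞) (f j)) (hg : ContDiff ℝ (⊤ : ℕ∞) g) (p e : Jet n M) :
    fderiv ℝ (fun p : Jet n M => g (trJ 2 h p) + ∑ j, coord p 2 j * f j (trJ 2 h p)) p e =
      fderiv ℝ (fun p : Jet n M => g (trJ 2 h p)) p e +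
      ∑ j, (coord p 2 j * fderiv ℝ (fun p : Jet n M => f j (trJ 2 h p)) p e
        + coord e 2 j * f j (trJ 2 h p)) := by
  have hG := (contDiff_comp_trJ h hg).differentiable (by simp) p
  have hF := fun j => (contDiff_comp_trJ h (hf j)).differentiable (by simp) p
  have hC := fun j => (contDiff_coord n M 2 j).differentiable (by simp) p
  rw [fderiv_fun_add hG (DifferentiableAt.fun_sum fun j _ => (hC j).fun_mul (hF j)),
    fderiv_fun_sum fun j _ => (hC j).fun_mul (hF j)]
  simp only [add_apply, sum_apply]
  congr 1
  refine Finset.sum_congr rfl fun j _ => ?_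
  rw [fderiv_fun_mul (hC j) (hF j)]
  simp only [add_apply, smul_apply, smul_eq_mul,
    fderiv_coord]
  ring

lemma totD_affine {n M : ℕ} (h : 3 ≤ M) {f : Fin n → Jet n 2 → ℝ} {g : Jet n 2 → ℝ}
    (hf : ∀ j, ContDiff ℝ (⊤ : ℕ∞) (f j)) (hg : ContDiff ℝ (⊤ : ℕ∞) g) (p : Jet n M) :
    totD (fun p : Jet n M =>
        g (trJ 2 (by omega) p) + ∑ j, coord p 2 j * f j (trJ 2 (by omega) p)) p =
      totD g (trJ 2 (by omega) p) + ∑ k, coord p 2 k * pderY 1 k g (trJ 2 (by omega) p) +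
      ∑ j, (coord p 2 j * (totD (f j) (trJ 2 (by omega) p)
          + ∑ k, coord p 2 k * pderY 1 k (f j) (trJ 2 (by omega) p))
        + coord p 3 j * f j (trJ 2 (by omega) p)) := by
  rw [totD_eq_fderiv, fderiv_affine _ hf hg]
  simp only [← totD_eq_fderiv, totD_comp_trJ _ hg, totD_comp_trJ _ (hf _),
    coord_totVec (show 2 < M by omega)]

lemma pderY_affine {n M : ℕ} (h : 3 ≤ M) {f : Fin n → Jet n 2 → ℝ} {g : Jet n 2 → ℝ}
    (hf : ∀ j, ContDiff ℝ (⊤ : ℕ∞) (f j)) (hg : ContDiff ℝ (⊤ : ℕ∞) g)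
    {r : ℕ} (hr : r < 2) (i : Fin n) :
    pderY r i (fun p : Jet n M =>
        g (trJ 2 (by omega) p) + ∑ j, coord p 2 j * f j (trJ 2 (by omega) p)) =
      fun p => pderY r i g (trJ 2 (by omega) p)
        + ∑ j, coord p 2 j * pderY r i (f j) (trJ 2 (by omega) p) := by
  funext p
  rw [pderY_eq_fderiv, fderiv_affine _ hf hg]
  simp only [fderiv_comp_trJ _ hg, fderiv_comp_trJ _ (hf _), trJ_jetUnit,
    coord_jetUnit (show 2 < M by omega), ← pderY_eq_fderiv]
  simp [hr.ne']

lemma pderY_two_affine {n M : ℕ} (h : 3 ≤ M) {f : Fin n → Jet n 2 → ℝ} {g : Jet n 2 → ℝ}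
    (hf : ∀ j, ContDiff ℝ (⊤ : ℕ∞) (f j)) (hg : ContDiff ℝ (⊤ : ℕ∞) g) (i : Fin n) :
    pderY 2 i (fun p : Jet n M =>
        g (trJ 2 (by omega) p) + ∑ j, coord p 2 j * f j (trJ 2 (by omega) p)) =
      fun p => f i (trJ 2 (by omega) p) := by
  funext p
  rw [pderY_eq_fderiv, fderiv_affine _ hf hg]
  simp only [fderiv_comp_trJ _ hg, fderiv_comp_trJ _ (hf _), trJ_jetUnit,
    coord_jetUnit (show 2 < M by omega), jetUnit_eq_zero le_rfl]
  simp

/-- The Euler–Poisson operator of an acceleration-affine Lagrange function, computed on any jet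
space `Jet n M` with `3 ≤ M`. -/
lemma eulerPoisson_affine {n M : ℕ} (h : 3 ≤ M) {α : Fin n → Jet n 2 → ℝ} {β : Jet n 2 → ℝ}
    (hα : ∀ j, ContDiff ℝ (⊤ : ℕ∞) (α j)) (hβ : ContDiff ℝ (⊤ : ℕ∞) β)
    {L : Jet n M → ℝ}
    (hL : L = fun p : Jet n M =>
      β (trJ 2 (by omega) p) + ∑ j, coord p 2 j * α j (trJ 2 (by omega) p))
    (i : Fin n) (p : Jet n M) :
    pderY 0 i L p - totD (pderY 1 i L) p + totD (totD (pderY 2 i L)) p =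
      (∑ j, (pderY 1 j (α i) (trJ 2 (by omega) p) - pderY 1 i (α j) (trJ 2 (by omega) p))
        * coord p 3 j)
      + (∑ j, ∑ k, coord p 2 k * (pderY 1 k (pderY 1 j (α i)) (trJ 2 (by omega) p)
          - pderY 1 k (pderY 1 i (α j)) (trJ 2 (by omega) p)) * coord p 2 j)
      + (∑ j, (pderY 0 i (α j) (trJ 2 (by omega) p)
          - totD (pderY 1 i (α j)) (trJ 2 (by omega) p)
          - pderY 1 j (pderY 1 i β) (trJ 2 (by omega) p)
          + pderY 1 j (totD (α i)) (trJ 2 (by omega) p)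
          + totD (pderY 1 j (α i)) (trJ 2 (by omega) p)) * coord p 2 j)
      + (pderY 0 i β (trJ 2 (by omega) p) - totD (pderY 1 i β) (trJ 2 (by omega) p)
          + totD (totD (α i)) (trJ 2 (by omega) p)) := by
  subst hL
  have e : totD (fun p : Jet n M => α i (trJ 2 (by omega) p)) = fun p =>
      totD (α i) (trJ 2 (by omega) p)
        + ∑ k, coord p 2 k * pderY 1 k (α i) (trJ 2 (by omega) p) :=
    funext (totD_comp_trJ _ (hα i))
  rw [pderY_affine h hα hβ (by norm_num), pderY_affine h hα hβ (by norm_num),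
    pderY_two_affine h hα hβ, e,
    totD_affine h (fun j => contDiff_pderY 1 i (hα j)) (contDiff_pderY 1 i hβ),
    totD_affine h (fun j => contDiff_pderY 1 j (hα i)) (contDiff_totD (hα i))]
  simp only [mul_add, add_mul, sub_mul, mul_sub, Finset.sum_add_distrib, Finset.sum_sub_distrib,
    Finset.mul_sum]
  simp only [mul_comm]
  ring

lemma trJ_embW0 {n : ℕ} (h : 2 ≤ 3) (q : Jet n 2) : trJ 2 h (embW0 q) = q := by
  ext
  · rfl
  · rename_i r k
    simp [trJ, embW0, show (r : ℕ) ≤ 1 by omega]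

lemma coord_embW0 {n : ℕ} (q : Jet n 2) (i : Fin n) : coord (embW0 q) 2 i = 0 := by
  simp [coord, embW0]

/-- The linear coefficient in `w` of a function polynomial of degree `≤ 2` in `w`. -/
lemma pderY_two_quadratic_embW0 {n : ℕ} {Q : Fin n → Fin n → Jet n 2 → ℝ}
    {f : Fin n → Jet n 2 → ℝ} {g : Jet n 2 → ℝ}
    (hQ : ∀ j k, ContDiff ℝ (⊤ : ℕ∞) (Q j k))
    (hf : ∀ j, ContDiff ℝ (⊤ : ℕ∞) (f j)) (hg : ContDiff ℝ (⊤ : ℕ∞) g)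
    (i : Fin n) (q : Jet n 2) :
    pderY 2 i (fun p : Jet n 3 =>
        (∑ j, ∑ k, coord p 2 k * Q j k (trJ 2 (by omega) p) * coord p 2 j)
        + (∑ j, f j (trJ 2 (by omega) p) * coord p 2 j) + g (trJ 2 (by omega) p)) (embW0 q) =
      f i q := by
  have hC := fun j => (contDiff_coord n 3 2 j).differentiable (by simp) (embW0 q)
  have hQ' := fun j k => (contDiff_comp_trJ (show 2 ≤ 3 by omega) (hQ j k)).differentiable
    (by simp) (embW0 q)
  have hS : ∀ j k, HasFDerivAt (fun p : Jet n 3 =>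
      coord p 2 k * Q j k (trJ 2 (by omega) p) * coord p 2 j) (0 : Jet n 3 →L[ℝ] ℝ)
      (embW0 q) := by
    intro j k
    refine (((hC k).hasFDerivAt.mul (hQ' j k).hasFDerivAt).mul
      (hC j).hasFDerivAt).congr_fderiv ?_
    simp [coord_embW0]
  have hsum : HasFDerivAt (fun p : Jet n 3 =>
      ∑ j, ∑ k, coord p 2 k * Q j k (trJ 2 (by omega) p) * coord p 2 j)
      (0 : Jet n 3 →L[ℝ] ℝ) (embW0 q) := by
    simpa using HasFDerivAt.fun_sum (u := Finset.univ) fun j _ =>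
      HasFDerivAt.fun_sum (u := Finset.univ) fun k _ => hS j k
  have haff : DifferentiableAt ℝ (fun p : Jet n 3 =>
      g (trJ 2 (by omega) p) + ∑ j, coord p 2 j * f j (trJ 2 (by omega) p)) (embW0 q) :=
    ((contDiff_comp_trJ _ hg).add (ContDiff.sum fun j _ =>
      (contDiff_coord n 3 2 j).mul (contDiff_comp_trJ _ (hf j)))).differentiable (by simp) _
  have key := congrFun (pderY_two_affine le_rfl hf hg i) (embW0 q)
  rw [trJ_embW0] at key
  rw [← key, pderY_eq_fderiv, pderY_eq_fderiv]
  have := (hsum.add haff.hasFDerivAt).fderiv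
  rw [zero_add] at this
  rw [← this]
  congr 2
  funext p
  simp only [Pi.add_apply, mul_comm]
  ring

/-- For a smooth second-order Lagrange function
`L(t,x,v,w) = Σ_j α_j(t,x,v) w^j + β(t,x,v)` affine in the accelerations `w`, the
Euler–Poisson expressions have the third-order shape
`E_i = A_{ij}w′^j + w^k(∂A_{ij}/∂v^k)w^j + B_{ij}w^j + c_i` with
`A_{ij} = ∂α_i/∂v^j − ∂α_j/∂v^i` skew-symmetric, `c_i = b_i|_{w=0}`,
`B_{ij} = (∂b_i/∂w^j)|_{w=0}`, where `b_i = ∂L/∂x^i − D₂(∂L/∂v^i) + D₂²(∂L/∂w^i)`;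
moreover `b_i` is a polynomial of degree ≤ 2 in `w` with quadratic part
`w^k(∂A_{ij}/∂v^k)w^j`. -/
theorem statement_5 (n : ℕ) (hn : 1 ≤ n)
    (α : Fin n → Jet n 2 → ℝ) (β : Jet n 2 → ℝ)
    (hα : ∀ j, ContDiff ℝ (⊤ : ℕ∞) (α j)) (hβ : ContDiff ℝ (⊤ : ℕ∞) β)
    (L : Jet n 3 → ℝ)
    (hLdef : ∀ p : Jet n 3,
      L p = (∑ j, α j (trJ 2 (by omega) p) * coord p 2 j) + β (trJ 2 (by omega) p))
    (A : Fin n → Fin n → Jet n 2 → ℝ)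
    (hAdef : ∀ i j q, A i j q = pderY 1 j (α i) q - pderY 1 i (α j) q)
    (b : Fin n → Jet n 3 → ℝ)
    (hbdef : ∀ i q, b i q =
      pderY 0 i L q - totD (pderY 1 i L) q + totD (totD (pderY 2 i L)) q)
    (c : Fin n → Jet n 2 → ℝ) (hcdef : ∀ i q, c i q = b i (embW0 q))
    (B : Fin n → Fin n → Jet n 2 → ℝ)
    (hBdef : ∀ i j q, B i j q = pderY 2 j (b i) (embW0 q)) :
    -- A is skew-symmetric
    (∀ i j q, A i j q = - A j i q) ∧
    -- the Euler–Poisson expressions have the stated third-order shape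
    (∀ (i : Fin n) (p : Jet n 5),
      eulerPoisson2 L i p =
        (∑ j, A i j (trJ 2 (by omega) p) * coord p 3 j)
        + (∑ j, ∑ k, coord p 2 k * pderY 1 k (A i j) (trJ 2 (by omega) p) * coord p 2 j)
        + (∑ j, B i j (trJ 2 (by omega) p) * coord p 2 j)
        + c i (trJ 2 (by omega) p)) ∧
    -- b_i is a polynomial of degree ≤ 2 in w whose quadratic part is w^k(∂A_{ij}/∂v^k)w^j
    (∀ (i : Fin n) (q : Jet n 3),
      b i q =
        (∑ j, ∑ k, coord q 2 k * pderY 1 k (A i j) (trJ 2 (by omega) q) * coord q 2 j)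
        + (∑ j, B i j (trJ 2 (by omega) q) * coord q 2 j)
        + c i (trJ 2 (by omega) q)) := by
  have hA : ∀ i j, A i j = fun q => pderY 1 j (α i) q - pderY 1 i (α j) q :=
    fun i j => funext (hAdef i j)
  have hdA : ∀ i j k q, pderY 1 k (A i j) q =
      pderY 1 k (pderY 1 j (α i)) q - pderY 1 k (pderY 1 i (α j)) q := by
    intro i j k q
    rw [hA, pderY_eq_fderiv, fderiv_fun_sub
      ((contDiff_pderY 1 j (hα i)).differentiable (by simp) q)
      ((contDiff_pderY 1 i (hα j)).differentiable (by simp) q)]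
    rfl
  let B' : Fin n → Fin n → Jet n 2 → ℝ := fun i j q =>
    pderY 0 i (α j) q - totD (pderY 1 i (α j)) q - pderY 1 j (pderY 1 i β) q
      + pderY 1 j (totD (α i)) q + totD (pderY 1 j (α i)) q
  let c' : Fin n → Jet n 2 → ℝ := fun i q =>
    pderY 0 i β q - totD (pderY 1 i β) q + totD (totD (α i)) q
  have hAs : ∀ i j, ContDiff ℝ (⊤ : ℕ∞) (A i j) := by
    intro i j
    rw [hA]
    exact (contDiff_pderY 1 j (hα i)).sub (contDiff_pderY 1 i (hα j))
  have hBs : ∀ i j, ContDiff ℝ (⊤ : ℕ∞) (B' i j) := fun i j =>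
    ((((contDiff_pderY 0 i (hα j)).sub (contDiff_totD (contDiff_pderY 1 i (hα j)))).sub
      (contDiff_pderY 1 j (contDiff_pderY 1 i hβ))).add
      (contDiff_pderY 1 j (contDiff_totD (hα i)))).add
      (contDiff_totD (contDiff_pderY 1 j (hα i)))
  have hcs : ∀ i, ContDiff ℝ (⊤ : ℕ∞) (c' i) := fun i =>
    ((contDiff_pderY 0 i hβ).sub (contDiff_totD (contDiff_pderY 1 i hβ))).add
      (contDiff_totD (contDiff_totD (hα i)))
  have hL : L = fun p : Jet n 3 =>
      β (trJ 2 (by omega) p) + ∑ j, coord p 2 j * α j (trJ 2 (by omega) p) := by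
    funext p
    rw [hLdef, add_comm]
    simp only [mul_comm]
  have hb : ∀ i, b i = fun q : Jet n 3 =>
      (∑ j, ∑ k, coord q 2 k * pderY 1 k (A i j) (trJ 2 (by omega) q) * coord q 2 j)
      + (∑ j, B' i j (trJ 2 (by omega) q) * coord q 2 j) + c' i (trJ 2 (by omega) q) := by
    intro i
    funext q
    rw [hbdef, eulerPoisson_affine le_rfl hα hβ hL]
    have h3 : ∀ j, coord q 3 j = 0 := fun j => by simp [coord]
    simp only [h3, mul_zero, Finset.sum_const_zero, zero_add, hdA, B', c']
  have hc : ∀ i q, c i q = c' i q := by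
    intro i q
    rw [hcdef, hb]
    simp [coord_embW0, trJ_embW0]
  have hB : ∀ i j q, B i j q = B' i j q := by
    intro i j q
    rw [hBdef, hb]
    exact pderY_two_quadratic_embW0 (fun j k => contDiff_pderY 1 k (hAs i j)) (hBs i) (hcs i) j q
  refine ⟨fun i j q => by rw [hAdef, hAdef]; ring, fun i p => ?_, fun i q => ?_⟩
  · have hE : extJ (M := 5) (by omega) L = fun p : Jet n 5 =>
        β (trJ 2 (by omega) p) + ∑ j, coord p 2 j * α j (trJ 2 (by omega) p) := by
      rw [hL]
      rfl
    rw [eulerPoisson2, eulerPoisson_affine (by omega) hα hβ hE]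
    simp only [hAdef, hdA, hB, hc, B', c']
  · rw [hb]
    simp only [hB, hc]
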